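/- arXiv:2011.14096 — 6 statements merged into one kernel-verified Lean document; each statement's English description precedes it below -/
import Mathlib

section
/- Let A be an abelian category and m ≥ 1 an integer. Let P be a property of m-periodic complexes over A such that: (i) P is closed under isomorphism of m-periodic complexes; (ii) P holds for the zero complex and for every stalk complex (an m-periodic complex all of whose components except possibly one are zero, with all differentials zero); (iii) P is closed under extensions, i.e., for every short exact sequence 0 → U → V → W → 0 of m-periodic complexes (meaning 0 → U^i → V^i → W^i → 0 is exact in A for every i ∈ ZMod m), if P holds for U and for W then P holds for V. Then P holds for every m-periodic complex over A. -/
open CategoryTheory Limits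

namespace HomologicalComplex

open scoped ZeroObject

variable {A ι : Type*} [Category A] [Abelian A]

/-- The homological complex with prescribed components and zero differentials. -/
abbrev ofZeroDifferential (c : ComplexShape ι) (X : ι → A) : HomologicalComplex A c where
  X := X
  d _ _ := 0

/-- A property of complexes that holds for complexes with zero components and for stalk
complexes, and is closed under extensions, holds for the complexes with zero differentials
whose components vanish outside a finite set. -/
theorem prop_of_d_eq_zero_of_finite_support {c : ComplexShape ι}
    (P : HomologicalComplex A c → Prop)
    (hzero : ∀ V : HomologicalComplex A c, (∀ i, IsZero (V.X i)) → P V)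
    (hstalk : ∀ (V : HomologicalComplex A c) (i₀ : ι),
      (∀ i, i ≠ i₀ → IsZero (V.X i)) → (∀ i j, V.d i j = 0) → P V)
    (hext : ∀ (U V W : HomologicalComplex A c) (f : U ⟶ V) (g : V ⟶ W)
      (hfg : ∀ i, f.f i ≫ g.f i = 0),
      (∀ i, (ShortComplex.mk (f.f i) (g.f i) (hfg i)).ShortExact) → P U → P W → P V)
    (S : Finset ι) (V : HomologicalComplex A c) (hd : ∀ i j, V.d i j = 0)
    (hS : ∀ i, i ∉ S → IsZero (V.X i)) : P V := by
  classical
  induction S using Finset.induction_on generalizing V with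
  | empty => exact hzero V fun i => hS i (by simp)
  | insert a S _ ih =>
    have split : ∀ i, ∃ (X Y : A) (f : X ⟶ V.X i) (g : V.X i ⟶ Y) (w : f ≫ g = 0),
        (ShortComplex.mk f g w).ShortExact ∧ (i ≠ a → IsZero X) ∧
          (i ∉ S → IsZero Y) := by
      intro i
      by_cases hi : i = a
      · exact ⟨V.X i, (0 : A), 𝟙 _, 0, by simp,
          (ShortComplex.Splitting.ofIsIsoOfIsZero _ inferInstance (Limits.isZero_zero A)).shortExact,
          fun h => (h hi).elim, fun _ => Limits.isZero_zero A⟩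
      · exact ⟨(0 : A), V.X i, 0, 𝟙 _, by simp,
          (ShortComplex.Splitting.ofIsZeroOfIsIso _ (Limits.isZero_zero A) inferInstance).shortExact,
          fun _ => Limits.isZero_zero A, fun h => hS i (by simp [hi, h])⟩
    choose X Y f g w hex hX hY using split
    exact hext (ofZeroDifferential c X) V (ofZeroDifferential c Y)
      { f := f, comm' := by simp [hd] } { f := g, comm' := by simp [hd] } w hex
      (hstalk _ a hX (by simp)) (ih _ (by simp) hY)

/-- Every complex is an extension of complexes with zero differentials, namely of its images
by its cycles. -/
theorem exists_shortExact_d_eq_zero {c : ComplexShape ι} (V : HomologicalComplex A c) :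
    ∃ (U W : HomologicalComplex A c) (f : U ⟶ V) (g : V ⟶ W)
      (hfg : ∀ i, f.f i ≫ g.f i = 0),
      (∀ i, (ShortComplex.mk (f.f i) (g.f i) (hfg i)).ShortExact) ∧
        (∀ i j, U.d i j = 0) ∧ (∀ i j, W.d i j = 0) := by
  have w : ∀ i, kernel.ι (V.d i (c.next i)) ≫ factorThruImage (V.d i (c.next i)) = 0 :=
    fun i => by simp [← cancel_mono (image.ι (V.d i (c.next i)))]
  refine ⟨ofZeroDifferential c fun i => kernel (V.d i (c.next i)),
    ofZeroDifferential c fun i => image (V.d i (c.next i)),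
    { f := fun i => kernel.ι _, comm' := ?_ }, { f := fun i => factorThruImage _, comm' := ?_ },
    w, fun i => ?_, by simp, by simp⟩
  · intro i j hij
    obtain rfl := c.next_eq' hij
    simp
  · intro i j _
    rw [comp_zero, eq_comm, ← cancel_mono (image.ι (V.d j (c.next j)))]
    simp
  · exact
      { exact := by
          refine ShortComplex.exact_of_f_is_kernel _ (KernelFork.IsLimit.ofι _ _
            (fun k hk => kernel.lift _ k ?_) (fun _ _ => kernel.lift_ι _ _ _) ?_)
          · rw [← image.fac (V.d i (c.next i)), reassoc_of% hk, zero_comp]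
          · intro _ k _ b hb
            simpa [← cancel_mono (kernel.ι (V.d i (c.next i)))] using hb
        mono_f := inferInstanceAs (Mono (kernel.ι (V.d i (c.next i))))
        epi_g := inferInstanceAs (Epi (factorThruImage (V.d i (c.next i)))) }

end HomologicalComplex

/-- Let `A` be an abelian category and `m ≥ 1`. If a property `P` of
`m`-periodic complexes over `A` is closed under isomorphism, holds for the zero complex
and for every stalk complex, and is closed under extensions (with respect to degreewise
short exact sequences), then `P` holds for every `m`-periodic complex over `A`. -/
theorem periodic_complex_induction_stalk_extensions
    {A : Type*} [Category A] [Abelian A] (m : ℕ) (hm : 1 ≤ m)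
    (P : HomologicalComplex A (ComplexShape.up (ZMod m)) → Prop)
    (hiso : ∀ (V W : HomologicalComplex A (ComplexShape.up (ZMod m))),
      (V ≅ W) → P V → P W)
    (hzero : ∀ (V : HomologicalComplex A (ComplexShape.up (ZMod m))),
      (∀ i : ZMod m, IsZero (V.X i)) → P V)
    (hstalk : ∀ (V : HomologicalComplex A (ComplexShape.up (ZMod m))) (i₀ : ZMod m),
      (∀ i : ZMod m, i ≠ i₀ → IsZero (V.X i)) → (∀ i j : ZMod m, V.d i j = 0) → P V)
    (hext : ∀ (U V W : HomologicalComplex A (ComplexShape.up (ZMod m)))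
      (f : U ⟶ V) (g : V ⟶ W) (hfg : ∀ i : ZMod m, f.f i ≫ g.f i = 0),
      (∀ i : ZMod m, (ShortComplex.mk (f.f i) (g.f i) (hfg i)).ShortExact) →
      P U → P W → P V) :
    ∀ V : HomologicalComplex A (ComplexShape.up (ZMod m)), P V := by
  intro V
  have : NeZero m := ⟨by lia⟩
  have hP := HomologicalComplex.prop_of_d_eq_zero_of_finite_support P hzero hstalk hext
    Finset.univ
  obtain ⟨U, W, f, g, hfg, hex, hU, hW⟩ := V.exists_shortExact_d_eq_zero
  exact hext U V W f g hfg hex (hP U hU (by simp)) (hP W hW (by simp))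
end

section
/- Let R be a ring of finite global dimension, m ≥ 1 an integer, and V an m-periodic complex of R-modules such that every component V^i is a projective R-module. Then V is acyclic if and only if the identity chain map of V is null-homotopic (equivalently, V is isomorphic to the zero complex in the homotopy category of m-periodic complexes of R-modules). -/
open CategoryTheory Limits

universe u

namespace ChainComplex

variable {C : Type*} [Category* C] [Abelian C]

/-- A chain complex of projectives that is exact in positive degrees, together with a cokernel
of its last differential, is a projective resolution of that cokernel. -/
noncomputable abbrev projectiveResolution (K : ChainComplex C ℕ) [∀ n, Projective (K.X n)]
    (hK : ∀ n, K.ExactAt (n + 1)) {Z : C} (f : K.X 0 ⟶ Z) (w : K.d 1 0 ≫ f = 0)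
    (hf : (ShortComplex.mk _ _ w).Exact) (hf' : Epi f) : ProjectiveResolution Z where
  complex := K
  π := (K.toSingle₀Equiv Z).symm ⟨f, w⟩
  quasiIso := ⟨fun n ↦ by
    cases n with
    | zero =>
      rw [ChainComplex.quasiIsoAt₀_iff, ShortComplex.quasiIso_iff_of_zeros']
      · refine (ShortComplex.exact_and_epi_g_iff_of_iso ?_).2 ⟨hf, hf'⟩
        exact ShortComplex.isoMk (Iso.refl _) (Iso.refl _) (Iso.refl _)
          ((Category.id_comp _).trans (Category.comp_id _).symm)
          ((Category.id_comp _).trans ((Category.comp_id _).trans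
            (ChainComplex.toSingle₀Equiv_symm_apply_f_zero f w)).symm)
      · exact K.shape 0 0 (by simp)
      all_goals rfl
    | succ n =>
      rw [quasiIsoAt_iff_exactAt']
      · exact hK n
      · exact ChainComplex.exactAt_succ_single_obj _ _⟩

end ChainComplex

namespace CategoryTheory.ProjectiveResolution

variable {C : Type*} [Category* C] [Abelian C] [Linear ℤ C] [EnoughProjectives C]

/-- If `Ext (n + 1) X Y` vanishes, every `(n + 1)`-cocycle on a projective resolution is a
coboundary. -/
lemma exists_d_comp_eq_of_subsingleton_ext {X Y : C} (P : ProjectiveResolution X) (n : ℕ)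
    (h : Subsingleton (((Ext ℤ C (n + 1)).obj (Opposite.op X)).obj Y))
    (f : P.complex.X (n + 1) ⟶ Y) (hf : P.complex.d (n + 2) (n + 1) ≫ f = 0) :
    ∃ g : P.complex.X n ⟶ Y, P.complex.d (n + 1) n ≫ g = f := by
  have hz : IsZero ((P.complex.linearYonedaObj ℤ Y).homology (n + 1)) :=
    (ModuleCat.isZero_of_subsingleton _).of_iso (P.isoExt (n + 1) Y).symm
  rw [← HomologicalComplex.exactAt_iff_isZero_homology,
    HomologicalComplex.exactAt_iff' _ n (n + 1) (n + 2) (by simp) (by simp),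
    ShortComplex.moduleCat_exact_iff] at hz
  exact hz f hf

/-- If `Ext 0 X Y` vanishes, every `0`-cocycle on a projective resolution is zero. -/
lemma eq_zero_of_subsingleton_ext_zero {X Y : C} (P : ProjectiveResolution X)
    (h : Subsingleton (((Ext ℤ C 0).obj (Opposite.op X)).obj Y))
    (f : P.complex.X 0 ⟶ Y) (hf : P.complex.d 1 0 ≫ f = 0) : f = 0 := by
  have hz : IsZero ((P.complex.linearYonedaObj ℤ Y).homology 0) :=
    (ModuleCat.isZero_of_subsingleton _).of_iso (P.isoExt 0 Y).symm
  rw [← HomologicalComplex.exactAt_iff_isZero_homology,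
    HomologicalComplex.exactAt_iff' _ 0 0 1 (by simp) (by simp),
    ShortComplex.moduleCat_exact_iff] at hz
  obtain ⟨g, hg⟩ := hz f hf
  rw [← hg]
  change P.complex.d 0 0 ≫ _ = 0
  rw [P.complex.shape 0 0 (by simp)]
  exact zero_comp

end CategoryTheory.ProjectiveResolution

namespace HomologicalComplex

section

variable {C ι : Type*} [Category* C] [Abelian C] {c : ComplexShape ι}
  (K : HomologicalComplex C c)

lemma epi_toCycles_of_exactAt {i j : ι} (hij : c.Rel i j) (hK : K.ExactAt j) :
    Epi (K.toCycles i j) :=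
  Preadditive.epi_of_isZero_cokernel' _ (K.homologyIsCokernel i j (c.prev_eq' hij)) hK.isZero_homology

lemma iCycles_toCycles_exact {i j : ι} (hij : c.Rel i j) :
    (ShortComplex.mk (K.iCycles i) (K.toCycles i j)
      (by simp [← cancel_mono (K.iCycles j)])).Exact := by
  let φ : ShortComplex.mk (K.iCycles i) (K.toCycles i j)
      (by simp [← cancel_mono (K.iCycles j)]) ⟶
      ShortComplex.mk (K.iCycles i) (K.d i j) (by simp) :=
    { τ₁ := 𝟙 _, τ₂ := 𝟙 _, τ₃ := K.iCycles j }
  have : IsIso φ.τ₁ := inferInstanceAs (IsIso (𝟙 _))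
  have : IsIso φ.τ₂ := inferInstanceAs (IsIso (𝟙 _))
  have : Mono φ.τ₃ := inferInstanceAs (Mono (K.iCycles j))
  exact (ShortComplex.exact_iff_of_epi_of_isIso_of_mono φ).2
    (ShortComplex.exact_of_f_is_kernel _ (K.cyclesIsKernel i j (c.next_eq' hij)))

lemma d_toCycles_exact {i j k : ι} (hij : c.Rel i j) (hjk : c.Rel j k) (hK : K.ExactAt j) :
    (ShortComplex.mk (K.d i j) (K.toCycles j k) (by simp)).Exact := by
  let φ : ShortComplex.mk (K.d i j) (K.toCycles j k) (by simp) ⟶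
      ShortComplex.mk (K.d i j) (K.d j k) (by simp) :=
    { τ₁ := 𝟙 _, τ₂ := 𝟙 _, τ₃ := K.iCycles k }
  have : Epi φ.τ₁ := inferInstanceAs (Epi (𝟙 _))
  have : IsIso φ.τ₂ := inferInstanceAs (IsIso (𝟙 _))
  have : Mono φ.τ₃ := inferInstanceAs (Mono (K.iCycles k))
  exact (ShortComplex.exact_iff_of_epi_of_isIso_of_mono φ).2
    ((K.exactAt_iff' i j k (c.prev_eq' hij) (c.next_eq' hjk)).1 hK)

/-- An acyclic complex without end points is contractible as soon as all inclusions of cycles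
have retractions. -/
lemma nonempty_homotopy_of_retractions (hprev : ∀ i, c.Rel (c.prev i) i)
    (hnext : ∀ i, c.Rel i (c.next i)) (hK : ∀ i, K.ExactAt i)
    (hr : ∀ i, ∃ r : K.X i ⟶ K.cycles i, K.iCycles i ≫ r = 𝟙 _) :
    Nonempty (Homotopy (𝟙 K) 0) := by
  classical
  choose r hr using hr
  have hs (j i : ι) : ∃ s : K.cycles j ⟶ K.X i, (¬ c.Rel i j → s = 0) ∧
      (c.Rel i j → K.toCycles i j ≫ s = 𝟙 _ - r i ≫ K.iCycles i) ∧
      (c.Rel i j → s ≫ K.toCycles i j = 𝟙 _) := by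
    by_cases hij : c.Rel i j
    · have := K.epi_toCycles_of_exactAt hij (hK j)
      let t := (K.iCycles_toCycles_exact hij).desc (𝟙 _ - r i ≫ K.iCycles i)
        (by simp [reassoc_of% (hr i)])
      have ht : K.toCycles i j ≫ t = 𝟙 _ - r i ≫ K.iCycles i :=
        (K.iCycles_toCycles_exact hij).g_desc _ _
      refine ⟨t, fun h ↦ absurd hij h, fun _ ↦ ht, fun _ ↦ ?_⟩
      rw [← cancel_epi (K.toCycles i j), reassoc_of% ht, Preadditive.sub_comp, Category.assoc,
        (ShortComplex.mk (K.iCycles i) (K.toCycles i j)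
          (by simp [← cancel_mono (K.iCycles j)])).zero]
      simp
    · exact ⟨0, fun _ ↦ rfl, fun h ↦ absurd h hij, fun h ↦ absurd h hij⟩
  choose s hs₀ hs₁ hs₂ using hs
  refine ⟨{ hom := fun j i ↦ r j ≫ s j i
            zero := fun j i h ↦ by rw [hs₀ j i h, comp_zero]
            comm := fun i ↦ ?_ }⟩
  rw [dNext_eq _ (hnext i), prevD_eq _ (hprev i), ← K.toCycles_i i (c.next i),
    ← K.toCycles_i (c.prev i) i]
  simp only [Category.assoc, reassoc_of% hr, hs₁ _ _ (hnext i),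
    reassoc_of% (hs₂ _ _ (hprev i))]
  simp

lemma isZero_homology_of_homotopy (h : Homotopy (𝟙 K) 0) (i : ι) : IsZero (K.homology i) := by
  rw [IsZero.iff_id_eq_zero, ← homologyMap_id, h.homologyMap_eq, homologyMap_zero]

end

section

variable {C ι : Type*} [Category* C] [Abelian C] [AddCommGroupWithOne ι]
  (K : HomologicalComplex C (ComplexShape.up ι))

lemma up_rel_sub_succ (i : ι) (n : ℕ) :
    (ComplexShape.up ι).Rel (i - (n + 1 : ℕ)) (i - n) := by
  change _ + 1 = _
  push_cast
  abel

/-- The part of a complex in degrees `i, i - 1, i - 2, …`, unrolled to an `ℕ`-indexed chain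
complex (in a periodic complex, degrees get repeated). -/
noncomputable abbrev unrollBelow (i : ι) : ChainComplex C ℕ :=
  ChainComplex.of (fun n ↦ K.X (i - n)) (fun n ↦ K.d (i - (n + 1 : ℕ)) (i - n)) (by simp)

lemma unrollBelow_d (i : ι) (n : ℕ) :
    (K.unrollBelow i).d (n + 1) n = K.d (i - (n + 1 : ℕ)) (i - n) :=
  ChainComplex.of_d (fun n : ℕ ↦ K.X (i - n)) (fun n ↦ K.d (i - (n + 1 : ℕ)) (i - n)) n

lemma unrollBelow_exactAt_succ (i : ι) (n : ℕ) (hK : ∀ j, K.ExactAt j) :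
    (K.unrollBelow i).ExactAt (n + 1) := by
  rw [exactAt_iff' _ (n + 2) (n + 1) n (by simp) (by simp)]
  have h := (K.exactAt_iff' _ _ _
    ((ComplexShape.up ι).prev_eq' (up_rel_sub_succ i (n + 1)))
    ((ComplexShape.up ι).next_eq' (up_rel_sub_succ i n))).1 (hK _)
  refine (ShortComplex.exact_iff_of_iso ?_).1 h
  exact ShortComplex.isoMk (Iso.refl _) (Iso.refl _) (Iso.refl _)
    ((Category.id_comp _).trans ((K.unrollBelow_d i (n + 1)).trans (Category.comp_id _).symm))
    ((Category.id_comp _).trans ((K.unrollBelow_d i n).trans (Category.comp_id _).symm))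

/-- The unrolled part of an acyclic complex of projectives is a projective resolution of the
cycles in the next degree. -/
noncomputable abbrev cyclesResolution (hproj : ∀ i, Projective (K.X i))
    (hK : ∀ i, K.ExactAt i) (i j : ι) (hij : (ComplexShape.up ι).Rel (i - (0 : ℕ)) j) :
    ProjectiveResolution (K.cycles j) :=
  have (n : ℕ) : Projective ((K.unrollBelow i).X n) := hproj _
  have w : (K.unrollBelow i).d 1 0 ≫ K.toCycles (i - (0 : ℕ)) j = 0 :=
    (congrArg (· ≫ K.toCycles (i - (0 : ℕ)) j) (K.unrollBelow_d i 0)).trans (K.d_toCycles _ _ _)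
  have hw : (ShortComplex.mk _ _ w).Exact := by
    refine (ShortComplex.exact_iff_of_iso ?_).1
      (K.d_toCycles_exact (up_rel_sub_succ i 0) hij (hK _))
    exact ShortComplex.isoMk (Iso.refl _) (Iso.refl _) (Iso.refl _)
      ((Category.id_comp _).trans ((K.unrollBelow_d i 0).trans (Category.comp_id _).symm))
      ((Category.id_comp _).trans (Category.comp_id _).symm)
  ChainComplex.projectiveResolution (K.unrollBelow i)
    (fun n ↦ K.unrollBelow_exactAt_succ i n hK) (K.toCycles (i - (0 : ℕ)) j) w hw
    (K.epi_toCycles_of_exactAt hij (hK j))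

/-- If `Ext n` vanishes identically for some `n`, the cycles of an acyclic complex of projectives
are direct summands. -/
lemma exists_retraction_iCycles [Linear ℤ C] [EnoughProjectives C]
    (hproj : ∀ i, Projective (K.X i)) (hK : ∀ i, K.ExactAt i) (n : ℕ)
    (hn : ∀ X Y : C, Subsingleton (((Ext ℤ C n).obj (Opposite.op X)).obj Y)) (l : ι) :
    ∃ r : K.X l ⟶ K.cycles l, K.iCycles l ≫ r = 𝟙 _ := by
  cases n with
  | zero =>
    obtain ⟨i, hi⟩ : ∃ i : ι, (ComplexShape.up ι).Rel (i - (0 : ℕ)) l :=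
      ⟨l - 1, by change _ + 1 = _; simp⟩
    have := K.epi_toCycles_of_exactAt hi (hK l)
    have h₀ : K.toCycles (i - (0 : ℕ)) l = 0 :=
      (K.cyclesResolution hproj hK i l hi).eq_zero_of_subsingleton_ext_zero (hn _ _) _
        ((congrArg (· ≫ K.toCycles (i - (0 : ℕ)) l) (K.unrollBelow_d i 0)).trans
          (K.d_toCycles _ _ _))
    exact ⟨0, by rw [← cancel_epi (K.toCycles (i - (0 : ℕ)) l), h₀, zero_comp, zero_comp]⟩
  | succ n =>
    obtain ⟨i, rfl⟩ : ∃ i : ι, l = i - n := ⟨l + n, by simp⟩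
    have hi : (ComplexShape.up ι).Rel (i - (0 : ℕ)) (i + 1) := by change _ + 1 = _; simp
    have hrel := up_rel_sub_succ i n
    have := K.epi_toCycles_of_exactAt hrel (hK _)
    obtain ⟨g, hg⟩ := (K.cyclesResolution hproj hK i _ hi).exists_d_comp_eq_of_subsingleton_ext n
      (hn _ _) (K.toCycles (i - (n + 1 : ℕ)) (i - n))
      ((congrArg (· ≫ K.toCycles (i - (n + 1 : ℕ)) (i - n)) (K.unrollBelow_d i (n + 1))).trans
        (K.d_toCycles _ _ _))
    have hg' : K.d (i - (n + 1 : ℕ)) (i - n) ≫ g = K.toCycles (i - (n + 1 : ℕ)) (i - n) :=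
      (congrArg (· ≫ g) (K.unrollBelow_d i n)).symm.trans hg
    exact ⟨g, by
      rw [← cancel_epi (K.toCycles (i - (n + 1 : ℕ)) (i - n)), toCycles_i_assoc, Category.comp_id]
      exact hg'⟩

end

end HomologicalComplex

/-- Let `R` be a ring of finite global dimension, `m ≥ 1`, and `V` an
`m`-periodic complex of `R`-modules with projective components. Then `V` is acyclic if
and only if the identity chain map of `V` is null-homotopic. -/
theorem acyclic_iff_contractible_periodic_complex_of_projectives
    {R : Type u} [Ring R]
    (hgldim : ∃ n : ℕ, ∀ M N : ModuleCat.{u} R,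
      Subsingleton (((Ext ℤ (ModuleCat.{u} R) n).obj (Opposite.op M)).obj N))
    (m : ℕ) (hm : 1 ≤ m)
    (V : HomologicalComplex (ModuleCat.{u} R) (ComplexShape.up (ZMod m)))
    (hproj : ∀ i : ZMod m, Module.Projective R (V.X i)) :
    (∀ i : ZMod m, IsZero (V.homology i)) ↔ Nonempty (Homotopy (𝟙 V) 0) := by
  have hrel (i : ZMod m) : (ComplexShape.up (ZMod m)).Rel (i - 1) i := sub_add_cancel i 1
  have hrel' (i : ZMod m) : (ComplexShape.up (ZMod m)).Rel i (i + 1) := rfl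
  refine ⟨fun h ↦ ?_, fun ⟨h⟩ i ↦ V.isZero_homology_of_homotopy h i⟩
  obtain ⟨n, hn⟩ := hgldim
  have hV (i : ZMod m) : V.ExactAt i := (V.exactAt_iff_isZero_homology i).2 (h i)
  have hproj' (i : ZMod m) : Projective (V.X i) :=
    (IsProjective.iff_projective (R := R) (V.X i)).1 (hproj i)
  refine V.nonempty_homotopy_of_retractions (fun i ↦ ?_) (fun i ↦ ?_) hV
    (V.exists_retraction_iCycles hproj' hV n hn)
  · rw [ComplexShape.prev_eq' _ (hrel i)]
    exact hrel i
  · rw [ComplexShape.next_eq' _ (hrel' i)]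
    exact hrel' i
end

section
/- Let R be a ring of finite global dimension and m ≥ 1 an integer. Let f : V → W be a quasi-isomorphism of m-periodic complexes of R-modules such that every component of V and of W is a projective R-module. Then f is a homotopy equivalence: there exists a chain map g : W → V such that g ∘ f is homotopic to the identity of V and f ∘ g is homotopic to the identity of W. -/
open CategoryTheory Limits

universe u

namespace CategoryTheory.ProjectiveResolution

/-- If the left-derived functor `Ext^n` of Hom vanishes on `(X, Y)`, then so does the `Ext^n`-group
defined by the derived category. -/
lemma subsingleton_ext_of_subsingleton_derived_hom {A : Type*} [Ring A] {C : Type*} [Category* C]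
    [Abelian C] [Linear A C] [EnoughProjectives C] [HasExt C] {X Y : C}
    (P : ProjectiveResolution X) (n : ℕ)
    (h : Subsingleton (((Ext A C n).obj (Opposite.op X)).obj Y)) :
    Subsingleton (Abelian.Ext X Y n) := by
  have hexact : (P.complex.linearYonedaObj A Y).ExactAt n := by
    rw [HomologicalComplex.exactAt_iff_isZero_homology]
    exact (ModuleCat.isZero_of_subsingleton _).of_iso (P.isoExt n Y).symm
  refine subsingleton_of_forall_eq 0 fun e ↦ ?_
  obtain ⟨f, hf, rfl⟩ := P.extMk_surjective e (n + 1) rfl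
  have hbd (p : ℕ) (hp : (ComplexShape.up ℕ).prev n = p) :
      ∃ g : P.complex.X p ⟶ Y, P.complex.d n p ≫ g = f := by
    rw [HomologicalComplex.exactAt_iff' _ p n (n + 1) hp (by simp),
      ShortComplex.moduleCat_exact_iff] at hexact
    exact hexact f hf
  obtain _ | n := n
  · obtain ⟨g, rfl⟩ := hbd 0 (by simp)
    simp
  · exact (P.extMk_eq_zero_iff _ _ _ _ n rfl).2 (hbd n (by simp))

end CategoryTheory.ProjectiveResolution

/-- If `Ext^n(X, -)` vanishes, then `X` has projective dimension `< n`. -/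
lemma ModuleCat.hasProjectiveDimensionLT_of_subsingleton_derived_hom {R : Type u} [Ring R] (n : ℕ)
    (X : ModuleCat.{u} R)
    (h : ∀ Y : ModuleCat.{u} R,
      Subsingleton (((Ext ℤ (ModuleCat.{u} R) n).obj (Opposite.op X)).obj Y)) :
    HasProjectiveDimensionLT X n :=
  hasProjectiveDimensionLT_of_enoughInjectives X n fun Y ↦
    (ProjectiveResolution.of X).subsingleton_ext_of_subsingleton_derived_hom n (h Y)

namespace HomologicalComplex

variable {C ι : Type*} [Category* C] {c : ComplexShape ι}

section Acyclic

variable [Abelian C] {K : HomologicalComplex C c}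

/-- The short exact sequence `0 ⟶ Zⁱ ⟶ Kⁱ ⟶ Zʲ ⟶ 0` of an acyclic complex. -/
lemma Acyclic.shortExact_cycles (hK : K.Acyclic) {i j : ι} (hij : c.Rel i j) :
    (ShortComplex.mk (K.iCycles i) (K.toCycles i j)
      (by simp [← cancel_mono (K.iCycles j)])).ShortExact where
  exact := by
    rw [ShortComplex.exact_iff_exact_up_to_refinements]
    intro A x hx
    exact ⟨A, 𝟙 A, inferInstance, K.liftCycles x j (c.next_eq' hij)
      (by simpa using hx =≫ K.iCycles j), by simp⟩
  mono_f := by dsimp; infer_instance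
  epi_g := by
    obtain rfl := c.prev_eq' hij
    exact ((K.sc j).exact_iff_epi_toCycles).1 (hK j)

/-- In an acyclic complex of projective objects whose cycles have bounded projective dimension,
the cycles are projective. -/
lemma Acyclic.projective_cycles (hK : K.Acyclic) (hc : ∀ i, ∃ j, c.Rel i j)
    (hX : ∀ i, Projective (K.X i)) (n : ℕ)
    (hn : ∀ i, HasProjectiveDimensionLT (K.cycles i) (n + 1)) (i : ι) :
    Projective (K.cycles i) := by
  induction n generalizing i with
  | zero => exact projective_iff_hasProjectiveDimensionLT_one.2 (hn i)
  | succ n hrec =>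
    refine hrec (fun i ↦ ?_) i
    obtain ⟨j, hij⟩ := hc i
    exact ((hK.shortExact_cycles hij).hasProjectiveDimensionLT_X₃_iff n (hX i)).1 (hn j)

/-- An acyclic complex whose objects of cycles are projective is contractible. -/
lemma Acyclic.nonempty_homotopy_id_zero (hK : K.Acyclic) (hc : ∀ i, ∃ j, c.Rel i j)
    (hc' : ∀ j, ∃ i, c.Rel i j) (hZ : ∀ i, Projective (K.cycles i)) :
    Nonempty (Homotopy (𝟙 K) 0) := by
  have hsec (i j : ι) : ∃ s : K.cycles j ⟶ K.X i,
      c.Rel i j → s ≫ K.toCycles i j = 𝟙 (K.cycles j) := by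
    by_cases hij : c.Rel i j
    · have := (hK.shortExact_cycles hij).epi_g
      exact ⟨Projective.factorThru (𝟙 _) (K.toCycles i j), fun _ ↦ Projective.factorThru_comp _ _⟩
    · exact ⟨0, fun h ↦ (hij h).elim⟩
  choose s hs using hsec
  have hproj (j k : ι) (hjk : c.Rel j k) :
      (𝟙 _ - K.toCycles j k ≫ s j k) ≫ K.d j k = 0 := by
    rw [← K.toCycles_i j k, Preadditive.sub_comp, Category.assoc, reassoc_of% (hs j k hjk),
      Category.id_comp, sub_self]
  have hnext (j : ι) : c.Rel j (c.next j) := by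
    obtain ⟨k, hjk⟩ := hc j
    rwa [c.next_eq' hjk]
  classical
  refine ⟨{
    hom := fun j i ↦ if c.Rel i j then
      K.liftCycles (𝟙 _ - K.toCycles j (c.next j) ≫ s j (c.next j)) _ rfl
        (hproj j _ (hnext j)) ≫ s i j else 0
    zero := fun j i hij ↦ if_neg hij
    comm := fun j ↦ ?_ }⟩
  obtain ⟨i, hij⟩ := hc' j
  have hjk := hnext j
  have hd : K.d j (c.next j) ≫ K.toCycles (c.next j) (c.next (c.next j)) = 0 := by
    simp
  have hd' : K.d j (c.next j) ≫ K.liftCycles (𝟙 _ - K.toCycles _ (c.next _) ≫ s _ (c.next _)) _ rfl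
        (hproj _ _ (hnext (c.next j))) = K.toCycles j (c.next j) := by
    simp [← cancel_mono (K.iCycles _), reassoc_of% hd]
  have hs' : s i j ≫ K.d i j = K.iCycles j := by
    rw [← K.toCycles_i i j, reassoc_of% (hs i j hij)]
  rw [dNext_eq _ hjk, prevD_eq _ hij, if_pos hjk, if_pos hij]
  simp [reassoc_of% hd', hs']

end Acyclic

section HomotopyCofiber

open homotopyCofiber

variable [DecidableRel c.Rel]

/-- The homotopy cofiber of a quasi-isomorphism is acyclic. -/
lemma acyclic_homotopyCofiber [Abelian C] {K L : HomologicalComplex C c} (φ : K ⟶ L)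
    [QuasiIso φ] (hc : ∀ i, ∃ j, c.Rel i j)
    (hc' : ∀ j, ∃ i, c.Rel i j) : (homotopyCofiber φ).Acyclic := by
  intro j
  obtain ⟨i, hij⟩ := hc' j
  obtain ⟨k, hjk⟩ := hc j
  obtain ⟨l, hkl⟩ := hc k
  rw [exactAt_iff_exact_up_to_refinements _ i j k (c.prev_eq' hij) (c.next_eq' hjk)]
  intro A x hx
  change x ≫ homotopyCofiber.d φ j k = 0 at hx
  have hx₁ : (x ≫ fstX φ j k hjk) ≫ K.d k l = 0 := by
    have := hx =≫ fstX φ k l hkl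
    simpa [d_fstX φ _ _ _ hjk hkl] using this
  have hx₂ : (x ≫ fstX φ j k hjk) ≫ φ.f k + (x ≫ sndX φ j) ≫ L.d j k = 0 := by
    have := hx =≫ sndX φ k
    simpa [d_sndX φ _ _ hjk] using this
  obtain ⟨A₁, π₁, _, y, hy⟩ := (mono_homologyMap_iff_up_to_refinements φ j k l
    (c.prev_eq' hjk) (c.next_eq' hkl)).1 inferInstance _ hx₁ (-(x ≫ sndX φ j))
    (by simpa using eq_neg_of_add_eq_zero_left hx₂)
  obtain ⟨A₂, π₂, _, z, hz, w, hw⟩ := (epi_homologyMap_iff_up_to_refinements φ i j k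
    (c.prev_eq' hij) (c.next_eq' hjk)).1 inferInstance (π₁ ≫ x ≫ sndX φ j + y ≫ φ.f j) (by
      simp only [Preadditive.add_comp, Category.assoc, φ.comm, ← reassoc_of% hy]
      rw [← Preadditive.comp_add, add_comm]
      simpa using π₁ ≫= hx₂)
  refine ⟨A₂, π₂ ≫ π₁, inferInstance, (z - π₂ ≫ y) ≫ inlX φ j i hij + w ≫ inrX φ i, ?_⟩
  apply ext_to_X φ j k hjk
  · simp [homotopyCofiber, d_fstX φ _ _ _ hij hjk, hz, hy]
  · simp only [Preadditive.comp_add, ← Category.assoc] at hw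
    simp [homotopyCofiber, d_sndX φ _ _ hij, sub_add_eq_add_sub, ← hw]

/-- A morphism with a contractible homotopy cofiber is a homotopy equivalence. -/
lemma exists_homotopy_inverse_of_homotopyCofiber_contractible [Preadditive C]
    {K L : HomologicalComplex C c} (φ : K ⟶ L) [HasHomotopyCofiber φ]
    (hc : ∀ i, ∃ j, c.Rel i j) (hc' : ∀ j, ∃ i, c.Rel i j)
    (h : Homotopy (𝟙 (homotopyCofiber φ)) 0) :
    ∃ ψ : L ⟶ K, Nonempty (Homotopy (φ ≫ ψ) (𝟙 K)) ∧ Nonempty (Homotopy (ψ ≫ φ) (𝟙 L)) := by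
  have hprev (j : ι) : c.Rel (c.prev j) j := by
    obtain ⟨i, hij⟩ := hc' j
    rwa [c.prev_eq' hij]
  let s (j i : ι) : homotopyCofiber.X φ j ⟶ homotopyCofiber.X φ i := h.hom j i
  have hs (i j k : ι) (hij : c.Rel i j) (hjk : c.Rel j k) :
      s j i ≫ homotopyCofiber.d φ i j = 𝟙 _ - homotopyCofiber.d φ j k ≫ s k j := by
    have := h.comm j
    rw [dNext_eq _ hjk, prevD_eq _ hij] at this
    rw [eq_sub_iff_add_eq']
    simpa using this.symm
  let g (i j : ι) (hij : c.Rel i j) : L.X j ⟶ K.X j := inrX φ j ≫ s j i ≫ fstX φ i j hij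
  let ψ : L ⟶ K :=
    { f := fun j ↦ g _ j (hprev j)
      comm' := fun j k hjk ↦ by
        obtain rfl := c.prev_eq' hjk
        have := d_fstX φ _ _ _ (hprev _) hjk
        rw [← neg_eq_iff_eq_neg] at this
        simp only [g, Category.assoc, ← this, Preadditive.comp_neg]
        rw [reassoc_of% (hs _ _ _ (hprev _) hjk)]
        simp [Preadditive.sub_comp] }
  have hψ (i j : ι) (hij : c.Rel i j) : ψ.f j = inrX φ j ≫ s j i ≫ fstX φ i j hij := by
    obtain rfl := c.prev_eq' hij
    rfl
  refine ⟨ψ, ⟨⟨fun k j ↦ if hjk : c.Rel j k then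
      inlX φ k j hjk ≫ s j (c.prev j) ≫ fstX φ (c.prev j) j (hprev j) else 0,
      fun k j hjk ↦ dif_neg hjk, fun j ↦ ?_⟩⟩, ⟨⟨fun j i ↦ -(inrX φ j ≫ s j i ≫ sndX φ i),
      fun j i hij ↦ ?_, fun j ↦ ?_⟩⟩⟩
  · obtain ⟨k, hjk⟩ := hc j
    have hd := inlX_d φ _ _ _ (hprev j) hjk
    rw [eq_neg_add_iff_add_eq] at hd
    have hd' := d_fstX φ _ _ _ (hprev _) (hprev j)
    rw [← neg_eq_iff_eq_neg] at hd'
    obtain rfl := c.prev_eq' hjk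
    rw [dNext_eq _ hjk, prevD_eq _ (hprev _), dif_pos hjk, dif_pos (hprev _), comp_f,
      hψ _ _ (hprev _), ← reassoc_of% hd, Preadditive.add_comp]
    simp only [Category.assoc, ← hd', Preadditive.comp_neg]
    rw [reassoc_of% (hs _ _ _ (hprev _) (hprev (c.prev k)))]
    simp [Preadditive.sub_comp]
    abel
  · simp [s, h.zero j i hij]
  · obtain ⟨k, hjk⟩ := hc j
    have hd := d_sndX φ _ _ (hprev j)
    rw [← sub_eq_iff_eq_add] at hd
    rw [dNext_eq _ hjk, prevD_eq _ (hprev j), comp_f, hψ _ j (hprev j), Category.assoc,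
      Category.assoc, ← hd, Preadditive.comp_sub, reassoc_of% (hs _ _ _ (hprev j) hjk)]
    simp [Preadditive.sub_comp]
    abel

end HomotopyCofiber

end HomologicalComplex

/-- Let `R` be a ring of finite global dimension and `m ≥ 1`. A
quasi-isomorphism `f : V ⟶ W` of `m`-periodic complexes of `R`-modules whose components
are all projective is a homotopy equivalence: there is a chain map `g : W ⟶ V` with
`f ≫ g` homotopic to `𝟙 V` and `g ≫ f` homotopic to `𝟙 W`. -/
theorem quasiIso_is_homotopy_equiv_periodic_complexes_of_projectives
    {R : Type u} [Ring R]
    (hgldim : ∃ n : ℕ, ∀ M N : ModuleCat.{u} R,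
      Subsingleton (((Ext ℤ (ModuleCat.{u} R) n).obj (Opposite.op M)).obj N))
    (m : ℕ) (hm : 1 ≤ m)
    (V W : HomologicalComplex (ModuleCat.{u} R) (ComplexShape.up (ZMod m)))
    (hV : ∀ i : ZMod m, Module.Projective R (V.X i))
    (hW : ∀ i : ZMod m, Module.Projective R (W.X i))
    (f : V ⟶ W) (hf : QuasiIso f) :
    ∃ g : W ⟶ V, Nonempty (Homotopy (f ≫ g) (𝟙 V)) ∧ Nonempty (Homotopy (g ≫ f) (𝟙 W)) := by
  classical
  obtain ⟨n, hn⟩ := hgldim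
  have hc (i : ZMod m) : ∃ j, (ComplexShape.up (ZMod m)).Rel i j := ⟨i + 1, rfl⟩
  have hc' (j : ZMod m) : ∃ i, (ComplexShape.up (ZMod m)).Rel i j := ⟨j - 1, sub_add_cancel j 1⟩
  have hproj (i : ZMod m) : Projective ((HomologicalComplex.homotopyCofiber f).X i) := by
    exact .of_iso (HomologicalComplex.homotopyCofiber.XIsoBiprod f i (i + 1) rfl).symm inferInstance
  have hacyclic := HomologicalComplex.acyclic_homotopyCofiber f hc hc'
  obtain ⟨h⟩ := hacyclic.nonempty_homotopy_id_zero hc hc'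
    (hacyclic.projective_cycles hc hproj n fun i ↦
      have := ModuleCat.hasProjectiveDimensionLT_of_subsingleton_derived_hom n
        ((HomologicalComplex.homotopyCofiber f).cycles i) (hn _)
      hasProjectiveDimensionLT_of_ge _ n (n + 1) n.le_succ)
  exact HomologicalComplex.exists_homotopy_inverse_of_homotopyCofiber_contractible f hc hc' h
end

section
/- Let R be a ring of finite global dimension and m ≥ 1 an integer. Let P be an m-periodic complex of R-modules all of whose components are projective R-modules, and let W be an acyclic m-periodic complex of R-modules. Then every chain map f : P → W is null-homotopic. -/
open CategoryTheory Limits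

universe u

/-- If the `n`-th `Ext` groups out of `X`, computed as left derived functors, all vanish,
then `X` has projective dimension `< n`. -/
theorem hasProjectiveDimensionLT_of_subsingleton_leftDerived_ext
    {R : Type u} [Ring R] (X : ModuleCat.{u} R) (n : ℕ)
    (hX : ∀ Y : ModuleCat.{u} R,
      Subsingleton (((Ext ℤ (ModuleCat.{u} R) n).obj (Opposite.op X)).obj Y)) :
    HasProjectiveDimensionLT X n := by
  let := HasExt.standard (ModuleCat.{u} R)
  refine hasProjectiveDimensionLT_of_enoughInjectives X n fun Y => ?_
  refine subsingleton_of_forall_eq 0 fun e => ?_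
  let P := projectiveResolution X
  obtain ⟨f, hf, rfl⟩ := P.extMk_surjective e (n + 1) rfl
  have hex : (P.complex.linearYonedaObj ℤ Y).ExactAt n := by
    rw [HomologicalComplex.exactAt_iff_isZero_homology]
    have := hX Y
    exact (ModuleCat.isZero_of_subsingleton _).of_iso (P.isoExt n Y).symm
  cases n with
  | zero =>
    rw [HomologicalComplex.exactAt_iff' _ 0 0 1 (by simp) (by simp),
      ShortComplex.moduleCat_exact_iff] at hex
    obtain ⟨g, hg⟩ := hex f hf
    have hf0 : f = 0 := by
      rw [← hg]
      have h0 : (P.complex.linearYonedaObj ℤ Y).d 0 0 = 0 :=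
        (P.complex.linearYonedaObj ℤ Y).shape 0 0 (by simp)
      exact congrArg (fun φ => φ.hom g) h0
    subst hf0
    exact P.extMk_zero _ _
  | succ p =>
    rw [HomologicalComplex.exactAt_iff' _ p (p + 1) (p + 2) (by simp) (by simp),
      ShortComplex.moduleCat_exact_iff] at hex
    obtain ⟨g, hg⟩ := hex f hf
    exact (P.extMk_eq_zero_iff f _ rfl hf p rfl).2 ⟨g, hg⟩

/-- The kernel of a surjection from a projective module onto a module of projective dimension
`≤ n + 1` has projective dimension `≤ n`. -/
theorem hasProjectiveDimensionLE_of_exact_of_projective {R : Type u} [Ring R] {K F Z : Type u}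
    [AddCommGroup K] [Module R K] [AddCommGroup F] [Module R F] [AddCommGroup Z] [Module R Z]
    [Module.Projective R F] (i : K →ₗ[R] F) (q : F →ₗ[R] Z) (hi : Function.Injective i)
    (hiq : Function.Exact i q) (hq : Function.Surjective q) (n : ℕ)
    (hZ : HasProjectiveDimensionLE (ModuleCat.of R Z) (n + 1)) :
    HasProjectiveDimensionLE (ModuleCat.of R K) n := by
  let S : ShortComplex (ModuleCat.{u} R) := ShortComplex.mk (ModuleCat.ofHom i)
    (ModuleCat.ofHom q) (ModuleCat.hom_ext hiq.linearMap_comp_eq_zero)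
  have hS : S.ShortExact :=
    { exact := (ShortComplex.ShortExact.moduleCat_exact_iff_function_exact S).2 hiq
      mono_f := (ModuleCat.mono_iff_injective _).2 hi
      epi_g := (ModuleCat.epi_iff_surjective _).2 hq }
  have : Projective S.X₂ :=
    (IsProjective.iff_projective _).1 (inferInstanceAs (Module.Projective R F))
  exact (hS.hasProjectiveDimensionLT_X₃_iff n this).1 hZ

/-- A differential module which is exact and whose module of cycles is projective is
contractible. -/
theorem LinearMap.exists_contraction_of_projective_ker {R W : Type*} [Ring R]
    [AddCommGroup W] [Module R W] (d : W →ₗ[R] W) (hd : Function.Exact d d)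
    [Module.Projective R (LinearMap.ker d)] :
    ∃ k : W →ₗ[R] W, ∀ w, d (k w) + k (d w) = w := by
  let q : W →ₗ[R] LinearMap.ker d := d.codRestrict _ hd.apply_apply_eq_zero
  have hq : Function.Surjective q := fun z => by
    obtain ⟨w, hw⟩ := (hd z.1).1 z.2
    exact ⟨w, Subtype.ext hw⟩
  obtain ⟨s, hs⟩ := Module.projective_lifting_property q LinearMap.id hq
  have hds (z) : d (s z) = z.1 := congrArg Subtype.val (LinearMap.congr_fun hs z)
  let r : W →ₗ[R] LinearMap.ker d := (LinearMap.id - s ∘ₗ q).codRestrict _ fun w => by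
    simp [hds, q]
    exact sub_self _
  have hrq (w) : r (d w) = q w := by
    have : q (d w) = 0 := Subtype.ext (hd.apply_apply_eq_zero w)
    exact Subtype.ext (by simp [r, this]; rfl)
  refine ⟨s ∘ₗ r, fun w => ?_⟩
  simp only [LinearMap.comp_apply, hds, hrq]
  simp [r]

/-- A map of differential modules from a projective module to an exact one whose module of
cycles has finite projective dimension is null-homotopic. -/
theorem LinearMap.exists_homotopy_of_exact_of_hasProjectiveDimensionLE
    {R : Type u} [Ring R] {P : Type*} [AddCommGroup P] [Module R P] [Module.Projective R P]
    (dP : P →ₗ[R] P) (hdP : ∀ x, dP (dP x) = 0) (n : ℕ) :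
    ∀ (W : Type u) [AddCommGroup W] [Module R W] (d : W →ₗ[R] W), Function.Exact d d →
      HasProjectiveDimensionLE (ModuleCat.of R (LinearMap.ker d)) n →
      ∀ f : P →ₗ[R] W, (∀ x, f (dP x) = d (f x)) →
        ∃ h : P →ₗ[R] W, ∀ x, f x = d (h x) + h (dP x) := by
  induction n with
  | zero =>
    intro W _ _ d hd hpd f hf
    have : Module.Projective R (LinearMap.ker d) :=
      (IsProjective.iff_projective _).2 (projective_iff_hasProjectiveDimensionLE_zero _ |>.2 hpd)
    obtain ⟨k, hk⟩ := d.exists_contraction_of_projective_ker hd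
    exact ⟨k ∘ₗ f, fun x => by simp [hf, hk]⟩
  | succ n ih =>
    intro W _ _ d hd hpd f hf
    obtain ⟨F, _, _, _, p, hp⟩ : ∃ (F : Type u) (_ : AddCommGroup F) (_ : Module R F)
        (_ : Module.Projective R F) (p : F →ₗ[R] W), Function.Surjective p :=
      ⟨W →₀ R, inferInstance, inferInstance, inferInstance, Finsupp.linearCombination R _,
        Finsupp.linearCombination_id_surjective R W⟩
    let π : F × F →ₗ[R] W := p.coprod (d ∘ₗ p)
    let dQ : F × F →ₗ[R] F × F := LinearMap.inr R F F ∘ₗ LinearMap.fst R F F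
    have hπd (y) : π (dQ y) = d (π y) := by
      simp [π, dQ, hd.apply_apply_eq_zero]
    have hπ : Function.Surjective π := fun w => by
      obtain ⟨a, rfl⟩ := hp w
      exact ⟨(a, 0), by simp [π]⟩
    obtain ⟨g, hg⟩ := Module.projective_lifting_property π f hπ
    replace hg (x) : π (g x) = f x := LinearMap.congr_fun hg x
    let dK : LinearMap.ker π →ₗ[R] LinearMap.ker π := (-dQ).restrict fun y hy => by
      simp only [LinearMap.mem_ker] at hy
      simp [hπd, hy]
    have hdK (y) : (dK y).1 = -dQ y.1 := rfl
    have hker (y : LinearMap.ker π) : dK y = 0 ↔ y.1.1 = 0 := by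
      rw [← Subtype.coe_inj, hdK]
      simp [dQ]
    have hexK : Function.Exact dK dK := by
      rintro ⟨⟨a, b⟩, hab⟩
      rw [hker]
      constructor
      · rintro rfl
        obtain ⟨w, hw⟩ := (hd (p b)).1 (by simpa [π] using hab)
        obtain ⟨c, rfl⟩ := hp w
        refine ⟨⟨(-b, c), by simp [π, hw]⟩, Subtype.ext ?_⟩
        simp [hdK, dQ]
      · rintro ⟨y, hy⟩
        simpa [hdK, dQ] using (congrArg (fun z => z.1.1) hy).symm
    let ι : LinearMap.ker dK →ₗ[R] F :=
      LinearMap.snd R F F ∘ₗ (LinearMap.ker π).subtype ∘ₗ (LinearMap.ker dK).subtype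
    let q : F →ₗ[R] LinearMap.ker d := (d ∘ₗ p).codRestrict _ fun b => hd.apply_apply_eq_zero _
    have hq_zero (b) : q b = 0 ↔ d (p b) = 0 := Subtype.ext_iff
    have hιq : Function.Exact ι q := by
      intro b
      rw [hq_zero]
      constructor
      · intro hb
        exact ⟨⟨⟨(0, b), by simpa [π] using hb⟩, (hker _).2 rfl⟩, rfl⟩
      · rintro ⟨⟨⟨⟨a, b⟩, hab⟩, hy⟩, rfl⟩
        obtain rfl : a = 0 := (hker _).1 hy
        simpa [π, ι] using hab
    have hι : Function.Injective ι := by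
      rintro ⟨⟨⟨a, b⟩, hab⟩, hy⟩ ⟨⟨⟨a', b'⟩, hab'⟩, hy'⟩ h
      obtain rfl : a = 0 := (hker _).1 hy
      obtain rfl : a' = 0 := (hker _).1 hy'
      obtain rfl : b = b' := h
      rfl
    have hq : Function.Surjective q := fun z => by
      obtain ⟨w, hw⟩ := (hd z.1).1 z.2
      obtain ⟨b, rfl⟩ := hp w
      exact ⟨b, Subtype.ext hw⟩
    have hpdK : HasProjectiveDimensionLE (ModuleCat.of R (LinearMap.ker dK)) n :=
      hasProjectiveDimensionLE_of_exact_of_projective ι q hι hιq hq n hpd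
    let δ : P →ₗ[R] LinearMap.ker π := (dQ ∘ₗ g - g ∘ₗ dP).codRestrict _ fun x => by
      simp [hπd, hg, hf]
    have hδ (x) : (δ x).1 = dQ (g x) - g (dP x) := rfl
    have hdQ (y) : dQ (dQ y) = 0 := by simp [dQ]
    obtain ⟨k, hk⟩ := ih (LinearMap.ker π) dK hexK hpdK δ fun x => Subtype.ext (by
      simp [hδ, hdK, hdP, hdQ])
    let G : P →ₗ[R] F × F := g + (LinearMap.ker π).subtype ∘ₗ k
    have hG (x) : dQ (G x) = G (dP x) := by
      have := congrArg Subtype.val (hk x)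
      simp only [hδ, Submodule.coe_add, hdK] at this
      simp only [G, LinearMap.add_apply, LinearMap.comp_apply, Submodule.subtype_apply, map_add]
      rw [← sub_eq_zero] at this ⊢
      rw [← this]
      abel
    have hπG (x) : π (G x) = f x := by
      have : π (k x).1 = 0 := (k x).2
      simp [G, hg, this]
    let c : F × F →ₗ[R] F × F := LinearMap.inl R F F ∘ₗ LinearMap.snd R F F
    have hc (y) : dQ (c y) + c (dQ y) = y := by simp [c, dQ]
    refine ⟨π ∘ₗ c ∘ₗ G, fun x => ?_⟩
    simp only [LinearMap.comp_apply]
    rw [← hG, ← hπd, ← map_add, hc, hπG]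

namespace HomologicalComplex

variable {R : Type u} [Ring R] {m : ℕ}

/-- The differential of the product of all the components of a periodic complex. -/
noncomputable def piD (V : HomologicalComplex (ModuleCat.{u} R) (ComplexShape.up (ZMod m))) :
    (∀ i, V.X i) →ₗ[R] ∀ i, V.X i :=
  LinearMap.pi fun j => (V.d (j - 1) j).hom ∘ₗ LinearMap.proj (j - 1)

variable (V : HomologicalComplex (ModuleCat.{u} R) (ComplexShape.up (ZMod m)))

theorem piD_apply (v : ∀ i, V.X i) {i j : ZMod m} (hij : i + 1 = j) :
    V.piD v j = V.d i j (v i) := by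
  obtain rfl : i = j - 1 := eq_sub_of_add_eq hij
  rfl

theorem piD_single (i : ZMod m) (x : V.X i) :
    V.piD (Pi.single i x) = Pi.single (i + 1) (V.d i (i + 1) x) := by
  ext j
  by_cases hj : i + 1 = j
  · subst hj
    simp [V.piD_apply _ rfl]
  · have hj' : j - 1 ≠ i := fun h => hj (by simp [← h])
    rw [V.piD_apply _ (sub_add_cancel j 1), Pi.single_eq_of_ne hj',
      Pi.single_eq_of_ne (Ne.symm hj), map_zero]

theorem piD_piD (v : ∀ i, V.X i) : V.piD (V.piD v) = 0 := by
  ext j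
  rw [V.piD_apply _ (sub_add_cancel j 1), V.piD_apply _ (sub_add_cancel (j - 1) 1),
    ← ModuleCat.comp_apply, V.d_comp_d]
  rfl

theorem exact_piD (hV : ∀ i, IsZero (V.homology i)) : Function.Exact V.piD V.piD := by
  intro w
  refine ⟨fun hw => ?_, ?_⟩
  · have hex (i : ZMod m) : ∃ y : V.X i, V.d i (i + 1) y = w (i + 1) := by
      have := (V.exactAt_iff_isZero_homology (i + 1)).2 (hV (i + 1))
      rw [V.exactAt_iff' i (i + 1) (i + 1 + 1) (by simp) (by simp),
        ShortComplex.moduleCat_exact_iff] at this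
      refine this (w (i + 1)) ?_
      have h := congrFun hw (i + 1 + 1)
      rwa [V.piD_apply _ rfl] at h
    choose v hv using hex
    refine ⟨v, funext fun j => ?_⟩
    obtain ⟨i, rfl⟩ : ∃ i, i + 1 = j := ⟨j - 1, sub_add_cancel j 1⟩
    rw [V.piD_apply _ rfl, hv]
  · rintro ⟨v, rfl⟩
    exact V.piD_piD v

end HomologicalComplex

/-- Let `R` be a ring of finite global dimension and `m ≥ 1`. If `P` is
an `m`-periodic complex of `R`-modules all of whose components are projective and `W`
is an acyclic `m`-periodic complex of `R`-modules, then every chain map `f : P ⟶ W` is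
null-homotopic. -/
theorem chain_map_from_projectives_to_acyclic_nullHomotopic
    {R : Type u} [Ring R]
    (hgldim : ∃ n : ℕ, ∀ M N : ModuleCat.{u} R,
      Subsingleton (((Ext ℤ (ModuleCat.{u} R) n).obj (Opposite.op M)).obj N))
    (m : ℕ) (hm : 1 ≤ m)
    (P W : HomologicalComplex (ModuleCat.{u} R) (ComplexShape.up (ZMod m)))
    (hP : ∀ i : ZMod m, Module.Projective R (P.X i))
    (hW : ∀ i : ZMod m, IsZero (W.homology i))
    (f : P ⟶ W) :
    Nonempty (Homotopy f 0) := by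

  obtain ⟨n, hn⟩ := hgldim
  have : NeZero m := ⟨by lia⟩
  have : Module.Projective R (∀ i, P.X i) :=
    .of_equiv (DFinsupp.linearEquivFunOnFintype (R := R) (M := fun i => P.X i))
  have hpd : HasProjectiveDimensionLE (ModuleCat.of R (LinearMap.ker W.piD)) n := by
    have := hasProjectiveDimensionLT_of_subsingleton_leftDerived_ext
      (ModuleCat.of R (LinearMap.ker W.piD)) n (hn _)
    exact hasProjectiveDimensionLT_of_ge _ n (n + 1) n.le_succ
  let F : (∀ i, P.X i) →ₗ[R] ∀ i, W.X i :=
    LinearMap.pi fun i => (f.f i).hom ∘ₗ LinearMap.proj i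
  have hF (x : ∀ i, P.X i) : F (P.piD x) = W.piD (F x) := by
    ext j
    rw [W.piD_apply _ (sub_add_cancel j 1)]
    exact (ConcreteCategory.congr_hom (f.comm (j - 1) j) (x (j - 1))).symm
  obtain ⟨h, hh⟩ := LinearMap.exists_homotopy_of_exact_of_hasProjectiveDimensionLE
    P.piD P.piD_piD n (∀ i, W.X i) W.piD (W.exact_piD hW) hpd F hF
  let s (i j : ZMod m) : P.X i ⟶ W.X j :=
    ModuleCat.ofHom (LinearMap.proj j ∘ₗ h ∘ₗ LinearMap.single R (fun i => P.X i) i)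
  refine ⟨{ hom := fun i j => if j + 1 = i then s i j else 0
            zero := fun i j hij => if_neg hij
            comm := fun i => ?_ }⟩
  rw [dNext_eq _ (show (ComplexShape.up (ZMod m)).Rel i (i + 1) from rfl),
    prevD_eq _ (show (ComplexShape.up (ZMod m)).Rel (i - 1) i from sub_add_cancel i 1),
    if_pos rfl, if_pos (sub_add_cancel i 1), HomologicalComplex.zero_f, add_zero, add_comm]
  ext x
  have hx := congrFun (hh (Pi.single i x)) i
  rw [P.piD_single, Pi.add_apply, W.piD_apply _ (sub_add_cancel i 1)] at hx
  simpa [F, s] using hx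
end

section
/- Let R be a ring of finite global dimension and m ≥ 1 an integer. Then for every m-periodic complex V of R-modules there exist an m-periodic complex P of R-modules all of whose components are projective R-modules and a quasi-isomorphism p : P → V such that each component p^i : P^i → V^i is surjective. -/
open CategoryTheory Limits

universe u

/-- If the derived functor `Ext` vanishes in degree `n` on every pair of modules, then all
modules have projective dimension less than `n`. -/
theorem hasProjectiveDimensionLT_of_subsingleton_Ext {R : Type u} [Ring R] (n : ℕ)
    (h : ∀ M N : ModuleCat.{u} R,
      Subsingleton (((Ext ℤ (ModuleCat.{u} R) n).obj (Opposite.op M)).obj N))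
    (M : ModuleCat.{u} R) : HasProjectiveDimensionLT M n := by
  have P : ProjectiveResolution M := ProjectiveResolution.of M
  refine hasProjectiveDimensionLT_of_enoughInjectives M n fun N ↦
    subsingleton_of_forall_eq 0 fun e ↦ ?_
  obtain ⟨f, hf, rfl⟩ := P.extMk_surjective e (n + 1) rfl
  have hex : (P.complex.linearYonedaObj ℤ N).ExactAt n := by
    rw [HomologicalComplex.exactAt_iff_isZero_homology]
    have := h M N
    exact (ModuleCat.isZero_of_subsingleton _).of_iso (P.isoExt n N).symm
  rcases n with _ | p
  · rw [HomologicalComplex.exactAt_iff' _ 0 0 1 (by simp) (by simp),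
      ShortComplex.moduleCat_exact_iff] at hex
    obtain ⟨g, hg⟩ : ∃ g : P.complex.X 0 ⟶ N, P.complex.d 0 0 ≫ g = f := hex f hf
    have : f = 0 := by
      rw [← hg, P.complex.shape _ _ (by simp), zero_comp]
    subst this
    simp
  · rw [HomologicalComplex.exactAt_iff' _ p (p + 1) (p + 2) (by simp) (by simp),
      ShortComplex.moduleCat_exact_iff] at hex
    rw [P.extMk_eq_zero_iff f _ rfl hf p rfl]
    exact hex f hf

section PeriodicComplex

variable {R : Type u} [Ring R] {m : ℕ}

/-- An elementwise form of being a quasi-isomorphism. -/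
structure IsElementwiseQuasiIso
    {V W : HomologicalComplex (ModuleCat.{u} R) (ComplexShape.up (ZMod m))} (f : V ⟶ W) :
    Prop where
  inj : ∀ (i : ZMod m) (x : V.X (i + 1)), V.d (i + 1) (i + 1 + 1) x = 0 →
    ∀ w : W.X i, f.f (i + 1) x = W.d i (i + 1) w → ∃ y : V.X i, V.d i (i + 1) y = x
  surj : ∀ (i : ZMod m) (y : W.X (i + 1)), W.d (i + 1) (i + 1 + 1) y = 0 →
    ∃ (x : V.X (i + 1)) (w : W.X i), V.d (i + 1) (i + 1 + 1) x = 0 ∧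
      y = f.f (i + 1) x + W.d i (i + 1) w

theorem IsElementwiseQuasiIso.quasiIso
    {V W : HomologicalComplex (ModuleCat.{u} R) (ComplexShape.up (ZMod m))} {f : V ⟶ W}
    (hf : IsElementwiseQuasiIso f) : QuasiIso f := by
  rw [quasiIso_iff]
  intro j
  obtain ⟨i, rfl⟩ : ∃ i, i + 1 = j := ⟨j - 1, sub_add_cancel _ _⟩
  have hi : (ComplexShape.up (ZMod m)).prev (i + 1) = i := ComplexShape.prev_eq' _ rfl
  have hk : (ComplexShape.up (ZMod m)).next (i + 1) = i + 1 + 1 := ComplexShape.next_eq' _ rfl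
  rw [quasiIsoAt_iff_isIso_homologyMap]
  let π (A : ModuleCat.{u} R) : ModuleCat.of R (A →₀ R) ⟶ A :=
    ModuleCat.ofHom (Finsupp.linearCombination R id)
  have hπ (A : ModuleCat.{u} R) : Epi (π A) := by
    rw [ModuleCat.epi_iff_surjective]
    exact Finsupp.linearCombination_surjective R Function.surjective_id
  have : Mono (HomologicalComplex.homologyMap f (i + 1)) := by
    rw [HomologicalComplex.mono_homologyMap_iff_up_to_refinements f i (i + 1) _ hi hk]
    intro A x hx y hxy
    choose z hz using fun a : A ↦ hf.inj i (x a) (ConcreteCategory.congr_hom hx a) (y a)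
      (ConcreteCategory.congr_hom hxy a)
    refine ⟨_, π A, hπ A, ModuleCat.ofHom (Finsupp.linearCombination R z), ?_⟩
    ext a
    simp [π, hz]
  have : Epi (HomologicalComplex.homologyMap f (i + 1)) := by
    rw [HomologicalComplex.epi_homologyMap_iff_up_to_refinements f i (i + 1) _ hi hk]
    intro A y hy
    choose x w hx hw using fun a : A ↦ hf.surj i (y a) (ConcreteCategory.congr_hom hy a)
    refine ⟨_, π A, hπ A, ModuleCat.ofHom (Finsupp.linearCombination R x), ?_,
      ModuleCat.ofHom (Finsupp.linearCombination R w), ?_⟩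
    · ext a
      simp [hx]
    · ext a
      simp [π, hw]
  exact isIso_of_mono_of_epi _

/-- Every periodic complex is a quotient of a complex with projective components. -/
theorem exists_surjective_from_projectives
    (V : HomologicalComplex (ModuleCat.{u} R) (ComplexShape.up (ZMod m))) :
    ∃ (Q : HomologicalComplex (ModuleCat.{u} R) (ComplexShape.up (ZMod m))) (q : Q ⟶ V),
      (∀ i, Module.Projective R (Q.X i)) ∧ ∀ i, Function.Surjective (q.f i) := by
  let F := (∀ i, V.X i) →₀ R
  let φ (i : ZMod m) : F →ₗ[R] V.X i := Finsupp.linearCombination R fun g ↦ g i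
  have hφ (i : ZMod m) : Function.Surjective (φ i) :=
    Finsupp.linearCombination_surjective R (Function.surjective_eval i)
  let Q := CochainComplex.of (fun _ : ZMod m ↦ ModuleCat.of R (F × F))
    (fun _ ↦ ModuleCat.ofHom (LinearMap.inr R F F ∘ₗ LinearMap.fst R F F)) fun _ ↦ by
      ext <;> simp
  refine ⟨Q, { f i := ModuleCat.ofHom ((φ i).coprod ((V.d (i - 1) i).hom ∘ₗ φ (i - 1)))
               comm' := ?_ }, fun i ↦ ?_, fun i v ↦ ?_⟩
  · rintro i _ rfl
    have key : ∀ j, j = i → ∀ a, V.d j (i + 1) (φ j a) = V.d i (i + 1) (φ i a) := by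
      rintro _ rfl _
      rfl
    have hd (b : V.X (i - 1)) : V.d i (i + 1) (V.d (i - 1) i b) = 0 :=
      ConcreteCategory.congr_hom (V.d_comp_d (i - 1) i (i + 1)) b
    refine ModuleCat.hom_ext (LinearMap.ext fun ⟨a, b⟩ ↦ ?_)
    simp [Q, hd, key (i + 1 - 1) (add_sub_cancel_right _ _)]
  · change Module.Projective R (F × F)
    infer_instance
  · obtain ⟨a, rfl⟩ := hφ i v
    refine ⟨(a, 0), ?_⟩
    change φ i a + V.d (i - 1) i (φ (i - 1) 0) = φ i a
    simp

/-- The mapping cone of `f ≫ ι` resolves `V` if `f` resolves the kernel `ι` of `q : Q ⟶ V`. -/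
theorem exists_cone
    {P K Q V : HomologicalComplex (ModuleCat.{u} R) (ComplexShape.up (ZMod m))}
    (f : P ⟶ K) (ι : K ⟶ Q) (q : Q ⟶ V)
    (hP : ∀ i, Module.Projective R (P.X i)) (hQ : ∀ i, Module.Projective R (Q.X i))
    (hf : IsElementwiseQuasiIso f)
    (hι : ∀ i, Function.Injective (ι.f i)) (hιq : ∀ i, Function.Exact (ι.f i) (q.f i))
    (hq : ∀ i, Function.Surjective (q.f i)) :
    ∃ (C : HomologicalComplex (ModuleCat.{u} R) (ComplexShape.up (ZMod m))) (p : C ⟶ V),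
      (∀ i, Module.Projective R (C.X i)) ∧ IsElementwiseQuasiIso p ∧
        ∀ i, Function.Surjective (p.f i) := by
  have hfι (i : ZMod m) (x : P.X i) : Q.d i (i + 1) (ι.f i (f.f i x)) =
      ι.f (i + 1) (f.f (i + 1) (P.d i (i + 1) x)) :=
    ConcreteCategory.congr_hom ((f ≫ ι).comm i (i + 1)) x
  have hιd (i : ZMod m) (x : K.X i) : Q.d i (i + 1) (ι.f i x) = ι.f (i + 1) (K.d i (i + 1) x) :=
    ConcreteCategory.congr_hom (ι.comm i (i + 1)) x
  have hqd (i : ZMod m) (x : Q.X i) : V.d i (i + 1) (q.f i x) = q.f (i + 1) (Q.d i (i + 1) x) :=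
    ConcreteCategory.congr_hom (q.comm i (i + 1)) x
  have hPP (i : ZMod m) (x : P.X i) : P.d (i + 1) (i + 1 + 1) (P.d i (i + 1) x) = 0 :=
    ConcreteCategory.congr_hom (P.d_comp_d i (i + 1) (i + 1 + 1)) x
  have hQQ (i : ZMod m) (x : Q.X i) : Q.d (i + 1) (i + 1 + 1) (Q.d i (i + 1) x) = 0 :=
    ConcreteCategory.congr_hom (Q.d_comp_d i (i + 1) (i + 1 + 1)) x
  have hqι (i : ZMod m) (x : K.X i) : q.f i (ι.f i x) = 0 := (hιq i).apply_apply_eq_zero x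
  let δ (i : ZMod m) : (P.X (i + 1) × Q.X i) →ₗ[R] P.X (i + 1 + 1) × Q.X (i + 1) :=
    (-(P.d (i + 1) (i + 1 + 1)).hom ∘ₗ LinearMap.fst R _ _).prod
      (((f ≫ ι).f (i + 1)).hom.coprod (Q.d i (i + 1)).hom)
  have hδ (i : ZMod m) (x : P.X (i + 1)) (y : Q.X i) :
      δ i (x, y) = (-P.d (i + 1) (i + 1 + 1) x, ι.f (i + 1) (f.f (i + 1) x) + Q.d i (i + 1) y) :=
    rfl
  let C := CochainComplex.of (fun i : ZMod m ↦ ModuleCat.of R (P.X (i + 1) × Q.X i))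
    (fun i ↦ ModuleCat.ofHom (δ i)) fun i ↦ by
      refine ModuleCat.hom_ext (LinearMap.ext fun ⟨x, y⟩ ↦ ?_)
      change δ (i + 1) (δ i (x, y)) = 0
      simp [hδ, hPP, hQQ, hfι]
  have hC (i : ZMod m) (z : P.X (i + 1) × Q.X i) : C.d i (i + 1) z = δ i z :=
    ConcreteCategory.congr_hom (CochainComplex.of_d _ (fun i ↦ ModuleCat.ofHom (δ i)) i) z
  let p : C ⟶ V :=
    { f i := ModuleCat.ofHom ((q.f i).hom ∘ₗ LinearMap.snd R (P.X (i + 1)) (Q.X i))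
      comm' := by
        rintro i _ rfl
        refine ModuleCat.hom_ext (LinearMap.ext fun ⟨x, y⟩ ↦ ?_)
        change V.d i (i + 1) (q.f i y) = q.f (i + 1) (C.d i (i + 1) (x, y)).2
        rw [hC, hδ, hqd, map_add, hqι, zero_add] }
  have hp (i : ZMod m) (z : P.X (i + 1) × Q.X i) : p.f i z = q.f i z.2 := rfl
  refine ⟨C, p, fun i ↦ ?_, ⟨?_, ?_⟩, fun i v ↦ ?_⟩
  · have := hP (i + 1)
    have := hQ i
    change Module.Projective R (P.X (i + 1) × Q.X i)
    infer_instance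
  · rintro i ⟨x, y⟩ hxy v hv
    obtain ⟨y₀, rfl⟩ := hq i v
    rw [hC, hδ, Prod.mk_eq_zero, neg_eq_zero] at hxy
    obtain ⟨hx, hy⟩ := hxy
    rw [hp, hqd] at hv
    obtain ⟨k, hk⟩ := (hιq (i + 1) (y - Q.d i (i + 1) y₀)).1 (by rw [map_sub, hv, sub_self])
    have hkx : f.f (i + 1 + 1) x = K.d (i + 1) (i + 1 + 1) (-k) := by
      apply hι
      rw [← hιd, map_neg, hk, map_neg, map_sub, hQQ, sub_zero]
      exact eq_neg_of_add_eq_zero_left hy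
    obtain ⟨x₁, rfl⟩ := hf.inj (i + 1) x hx _ hkx
    obtain ⟨x₂, k₁, hx₂, hk₁⟩ := hf.surj i (f.f (i + 1) x₁ + k) (by
      apply hι
      rw [← hιd, map_add, map_add, hfι, hkx, map_neg, map_neg, hιd, neg_add_cancel, map_zero])
    refine ⟨(x₂ - x₁, y₀ + ι.f i k₁), ?_⟩
    rw [hC, hδ]
    refine Prod.ext ?_ ?_
    · simp [hx₂]
    · have := congrArg (ι.f (i + 1)) hk₁
      simp only [map_add, map_sub, hk, hιd] at this ⊢
      refine sub_eq_zero.1 (neg_eq_zero.1 (Eq.trans ?_ (sub_eq_zero.2 this)))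
      abel
  · intro i v hv
    obtain ⟨y, rfl⟩ := hq _ v
    rw [hqd] at hv
    obtain ⟨k, hk⟩ := (hιq _ _).1 hv
    obtain ⟨x, w, hx, hw⟩ := hf.surj (i + 1) k (by
      apply hι
      rw [← hιd, hk, hQQ, map_zero])
    refine ⟨(-x, y - ι.f _ w), 0, ?_, ?_⟩
    · rw [hC, hδ, Prod.mk_eq_zero]
      refine ⟨by simp [hx], ?_⟩
      rw [map_sub, ← hk, hιd, hw]
      simp
    · simp [hp, hqι]
  · obtain ⟨y, rfl⟩ := hq i v
    exact ⟨(0, y), rfl⟩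

/-- A periodic complex whose components have bounded projective dimension admits a surjective
quasi-isomorphism from a complex with projective components, by induction on the bound. -/
theorem exists_surjective_elementwiseQuasiIso (k : ℕ)
    (V : HomologicalComplex (ModuleCat.{u} R) (ComplexShape.up (ZMod m)))
    (hV : ∀ i, HasProjectiveDimensionLT (V.X i) (k + 1)) :
    ∃ (P : HomologicalComplex (ModuleCat.{u} R) (ComplexShape.up (ZMod m))) (p : P ⟶ V),
      (∀ i, Module.Projective R (P.X i)) ∧ IsElementwiseQuasiIso p ∧
        ∀ i, Function.Surjective (p.f i) := by
  induction k generalizing V with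
  | zero =>
    refine ⟨V, 𝟙 V, fun i ↦ ?_, ⟨fun i x _ w h ↦ ⟨w, by simpa using h.symm⟩,
      fun i y hy ↦ ⟨y, 0, hy, by simp⟩⟩, fun i x ↦ ⟨x, by simp⟩⟩
    have := hV i
    rw [IsProjective.iff_projective]
    rw [zero_add] at this
    infer_instance
  | succ k ih =>
    obtain ⟨Q, q, hQ, hq⟩ := exists_surjective_from_projectives V
    have hepi (i) : Epi (q.f i) := by
      rw [ModuleCat.epi_iff_surjective]
      exact hq i
    have : Epi q := HomologicalComplex.epi_of_epi_f _ hepi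
    let S := ShortComplex.mk (kernel.ι q) q (kernel.condition q)
    have hS : S.ShortExact := { exact := ShortComplex.exact_kernel q }
    have hSi (i) : (S.map (HomologicalComplex.eval _ _ i)).ShortExact :=
      hS.map_of_exact (HomologicalComplex.eval _ _ i)
    obtain ⟨P, f, hP, hf, -⟩ := ih (kernel q) fun i ↦ by
      have h₂ : Projective (S.map (HomologicalComplex.eval _ _ i)).X₂ :=
        (IsProjective.iff_projective _).1 (hQ i)
      exact ((hSi i).hasProjectiveDimensionLT_X₃_iff k h₂).1 (hV i)
    exact exists_cone f (kernel.ι q) q hP hQ hf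
      (fun i ↦ (hSi i).moduleCat_injective_f)
      (fun i ↦ (ShortComplex.ShortExact.moduleCat_exact_iff_function_exact _).1 (hSi i).exact) hq

end PeriodicComplex

/-- Let `R` be a ring of finite global dimension and `m ≥ 1`. Every
`m`-periodic complex `V` of `R`-modules admits a quasi-isomorphism `p : P ⟶ V` from an
`m`-periodic complex `P` all of whose components are projective, with every component
`p.f i` surjective. -/
theorem exists_surjective_quasiIso_from_projectives_periodic
    {R : Type u} [Ring R]
    (hgldim : ∃ n : ℕ, ∀ M N : ModuleCat.{u} R,
      Subsingleton (((Ext ℤ (ModuleCat.{u} R) n).obj (Opposite.op M)).obj N))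
    (m : ℕ) (hm : 1 ≤ m)
    (V : HomologicalComplex (ModuleCat.{u} R) (ComplexShape.up (ZMod m))) :
    ∃ (P : HomologicalComplex (ModuleCat.{u} R) (ComplexShape.up (ZMod m)))
      (p : P ⟶ V), (∀ i : ZMod m, Module.Projective R (P.X i)) ∧
      QuasiIso p ∧ ∀ i : ZMod m, Function.Surjective (p.f i) := by
  obtain ⟨n, hn⟩ := hgldim
  obtain ⟨P, p, hP, hp, hsurj⟩ := exists_surjective_elementwiseQuasiIso n V fun i ↦
    have := hasProjectiveDimensionLT_of_subsingleton_Ext n hn (V.X i)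
    hasProjectiveDimensionLT_of_ge _ n _ n.le_succ
  exact ⟨P, p, hP, hp.quasiIso, hsurj⟩
end

section
/- Let R be a hereditary ring, meaning that every submodule of a projective R-module is projective, and let m ≥ 2 be an integer. Let V be an m-periodic complex of R-modules all of whose components are projective R-modules. Then there exists a quasi-isomorphism from V to the m-periodic complex H(V) whose i-th component is the cohomology module H^i(V) for each i ∈ ZMod m and all of whose differentials are zero. -/
open CategoryTheory Limits

universe u

namespace HomologicalComplex

variable {C ι : Type*} [Category* C] [Abelian C] {c : ComplexShape ι}

/-- The chain map to a complex with zero differentials whose components are the homology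
objects of `K`, induced by retractions of `K` onto its cycles. -/
noncomputable def homOfCyclesRetractions {K L : HomologicalComplex C c}
    (hL : ∀ i j, L.d i j = 0) (r : ∀ i, K.X i ⟶ K.cycles i)
    (e : ∀ i, K.homology i ≅ L.X i) (hr : ∀ i, K.iCycles i ≫ r i = 𝟙 _) : K ⟶ L where
  f i := r i ≫ K.homologyπ i ≫ (e i).hom
  comm' i j _ := by
    rw [hL, comp_zero, ← K.toCycles_i i j, Category.assoc, reassoc_of% (hr j),
      K.toCycles_comp_homologyπ_assoc, zero_comp]

lemma quasiIso_homOfCyclesRetractions {K L : HomologicalComplex C c}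
    (hL : ∀ i j, L.d i j = 0) (r : ∀ i, K.X i ⟶ K.cycles i)
    (e : ∀ i, K.homology i ≅ L.X i) (hr : ∀ i, K.iCycles i ≫ r i = 𝟙 _) :
    QuasiIso (homOfCyclesRetractions hL r e hr) where
  quasiIsoAt i := by
    rw [quasiIsoAt_iff_isIso_homologyMap]
    set f := homOfCyclesRetractions hL r e hr
    have : IsIso (L.homologyπ i) := L.isIso_homologyπ _ i rfl (hL _ _)
    have : IsIso (L.iCycles i) := L.isIso_iCycles i _ rfl (hL _ _)
    have h : homologyMap f i ≫ inv (L.homologyπ i) ≫ L.iCycles i = (e i).hom := by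
      rw [← cancel_epi (K.homologyπ i), homologyπ_naturality_assoc, IsIso.hom_inv_id_assoc,
        cyclesMap_i]
      exact (reassoc_of% (hr i)) _
    exact IsIso.of_isIso_fac_right h

end HomologicalComplex

/-- A linear map with projective range admits a section on its range. -/
lemma LinearMap.exists_comp_comp_eq_self_of_projective_range {R M N : Type*} [Ring R]
    [AddCommGroup M] [AddCommGroup N] [Module R M] [Module R N] (d : M →ₗ[R] N)
    [Module.Projective R (LinearMap.range d)] :
    ∃ g : M →ₗ[R] M, d ∘ₗ g = d ∧ LinearMap.ker d ≤ LinearMap.ker g := by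
  obtain ⟨s, hs⟩ := Module.projective_lifting_property d.rangeRestrict LinearMap.id
    d.surjective_rangeRestrict
  refine ⟨s ∘ₗ d.rangeRestrict, ?_, fun x hx => ?_⟩
  · ext x
    exact congrArg Subtype.val (LinearMap.congr_fun hs (d.rangeRestrict x))
  · have : d.rangeRestrict x = 0 := Subtype.ext hx
    simp [this]

/-- If the range of the differential leaving degree `i` is projective, then the inclusion
of the cycles in degree `i` has a retraction. -/
lemma HomologicalComplex.exists_iCycles_comp_eq_id {R : Type u} [Ring R] {ι : Type*}
    {c : ComplexShape ι} (K : HomologicalComplex (ModuleCat.{u} R) c) (i : ι)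
    [Module.Projective R (LinearMap.range (K.d i (c.next i)).hom)] :
    ∃ r : K.X i ⟶ K.cycles i, K.iCycles i ≫ r = 𝟙 _ := by
  obtain ⟨g, hg, hker⟩ :=
    (K.d i (c.next i)).hom.exists_comp_comp_eq_self_of_projective_range
  have hgd : ModuleCat.ofHom g ≫ K.d i (c.next i) = K.d i (c.next i) :=
    ModuleCat.hom_ext hg
  have hig : K.iCycles i ≫ ModuleCat.ofHom g = 0 := by
    ext x
    exact hker (LinearMap.congr_fun (congrArg ModuleCat.Hom.hom (K.iCycles_d i (c.next i))) x)
  refine ⟨K.liftCycles (𝟙 _ - ModuleCat.ofHom g) _ rfl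
    (by rw [Preadditive.sub_comp, hgd, Category.id_comp, sub_self]), ?_⟩
  rw [← cancel_mono (K.iCycles i), Category.assoc, K.liftCycles_i, Preadditive.comp_sub, hig,
    Category.comp_id, Category.id_comp, sub_zero]

/-- Let `R` be a hereditary ring (every submodule of a projective
`R`-module is projective) and `m ≥ 2`. Let `V` be an `m`-periodic complex of
`R`-modules all of whose components are projective, and let `HV` be the `m`-periodic
complex whose `i`-th component is the cohomology `H^i(V)` and whose differentials all
vanish. Then there exists a quasi-isomorphism `V ⟶ HV`. -/
theorem exists_quasiIso_to_homology_periodic_complex_hereditary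
    {R : Type u} [Ring R]
    (hhered : ∀ (M : ModuleCat.{u} R), Module.Projective R M →
      ∀ (N : Submodule R M), Module.Projective R N)
    (m : ℕ) (hm : 2 ≤ m)
    (V : HomologicalComplex (ModuleCat.{u} R) (ComplexShape.up (ZMod m)))
    (hproj : ∀ i : ZMod m, Module.Projective R (V.X i))
    (HV : HomologicalComplex (ModuleCat.{u} R) (ComplexShape.up (ZMod m)))
    (hHX : ∀ i : ZMod m, HV.X i = V.homology i)
    (hHd : ∀ i j : ZMod m, HV.d i j = 0) :
    ∃ f : V ⟶ HV, QuasiIso f := by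
  have (i : ZMod m) : ∃ r : V.X i ⟶ V.cycles i, V.iCycles i ≫ r = 𝟙 _ := by
    have := hhered _ (hproj ((ComplexShape.up (ZMod m)).next i))
      (LinearMap.range (V.d i ((ComplexShape.up (ZMod m)).next i)).hom)
    exact V.exists_iCycles_comp_eq_id i
  choose r hr using this
  exact ⟨_, HomologicalComplex.quasiIso_homOfCyclesRetractions hHd r
    (fun i => eqToIso (hHX i).symm) hr⟩
end
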